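/- For every prime p ≥ 5, deg ss_p(X) = L(p) if and only if p divides #𝕄, the order of the Monster simple group (equivalently, if and only if p ∈ {5, 7, 11, 13, 17, 19, 23, 29, 31, 41, 47, 59, 71}). -/

import Mathlib

open Polynomial

noncomputable section

/-- The class number h(√-d) of the imaginary quadratic field ℚ(√-d),
realized as the subfield of ℂ generated by i·√d. -/
def classNumberSqrtNeg (d : ℕ) : ℕ :=
  haveI : FiniteDimensional ℚ (IntermediateField.adjoin ℚ {(Complex.I * Real.sqrt d : ℂ)}) :=
    IntermediateField.adjoin.finiteDimensional
      ⟨X ^ 2 + C (d : ℚ), monic_X_pow_add_C _ (by norm_num), by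
        have h : (Complex.I * (Real.sqrt d : ℂ)) ^ 2 = -(d : ℂ) := by
          rw [mul_pow, Complex.I_sq, ← Complex.ofReal_pow, Real.sq_sqrt (Nat.cast_nonneg d)]
          simp
        simp [h]⟩
  haveI : NumberField (IntermediateField.adjoin ℚ {(Complex.I * Real.sqrt d : ℂ)}) := ⟨⟩
  NumberField.classNumber (IntermediateField.adjoin ℚ {(Complex.I * Real.sqrt d : ℂ)})

variable (p : ℕ) [Fact p.Prime]

/-- ε = (1 - (-1|p))/2 -/
def eps : ℕ := ((1 - legendreSym p (-1)) / 2).toNat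
/-- δ = (1 - (-3|p))/2 -/
def del : ℕ := ((1 - legendreSym p (-3)) / 2).toNat
/-- ν = (1 - (-2|p))/2 -/
def nu : ℕ := ((1 - legendreSym p (-2)) / 2).toNat

/-- The Pochhammer symbol (x)_n = x(x+1)⋯(x+n-1) in 𝔽_p. -/
def poch (x : ZMod p) (n : ℕ) : ZMod p := (ascPochhammer (ZMod p) n).eval x

/-- Deuring's supersingular polynomial ss_p(X) ∈ 𝔽_p[X], via its hypergeometric
expression: (X-1728)^ε · Σ_{n=0}^{m} ((-m)_n (β)_n / (n!)²) 1728^n X^{m+δ-n},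
with m = ⌊p/12⌋ and β = 5/12 - (2δ-3ε)/6. -/
def ssPoly : (ZMod p)[X] :=
  (X - C 1728) ^ eps p *
    ∑ n ∈ Finset.range (p / 12 + 1),
      C (poch p (-(p / 12 : ℕ) : ZMod p) n *
         poch p ((5 : ZMod p) / 12 - (((2 * (del p : ℤ) - 3 * (eps p : ℤ)) : ℤ) : ZMod p) / 6) n /
         ((n.factorial : ZMod p)) ^ 2 * 1728 ^ n) *
      X ^ (p / 12 + del p - n)

/-- L(p): the number of distinct roots of ss_p(X) in 𝔽_p. -/
def LL : ℕ := (ssPoly p).roots.toFinset.card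

/-- The order of the Monster simple group 𝕄. -/
def monsterOrder : ℕ :=
  2 ^ 46 * 3 ^ 20 * 5 ^ 9 * 7 ^ 6 * 11 ^ 2 * 13 ^ 3 * 17 * 19 * 23 * 29 * 31 * 41 * 47 * 59 * 71

/-- The order of the Baby monster group 𝔹. -/
def babyMonsterOrder : ℕ :=
  2 ^ 41 * 3 ^ 13 * 5 ^ 6 * 7 ^ 2 * 11 * 13 * 17 * 19 * 23 * 31 * 47

/-- The order of Fischer's sporadic group Fi′₂₄. -/
def fischer24Order : ℕ :=
  2 ^ 21 * 3 ^ 16 * 5 ^ 2 * 7 ^ 3 * 11 * 13 * 17 * 23 * 29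

/-- The hypergeometric operator `X(1 - X)D² + (1 - 2X)D - 3/16`, which annihilates
`₂F₁(1/4, 3/4; 1; X)`. -/
def hypOp {F : Type*} [Field F] (f : F[X]) : F[X] :=
  X * (1 - X) * derivative (derivative f) + (1 - 2 * X) * derivative f - C (3 / 16) * f

theorem hypOp_linear {F : Type*} [Field F] (a b : F) (f g : F[X]) :
    hypOp (C a * f - C b * g) = C a * hypOp f - C b * hypOp g := by
  simp only [hypOp, derivative_sub, derivative_C_mul]
  ring

theorem coeff_succ_of_hypOp_eq_zero {F : Type*} [Field F] {f : F[X]} (hf : hypOp f = 0) (n : ℕ) :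
    ((n : F) + 1) ^ 2 * f.coeff (n + 1) = ((n : F) ^ 2 + n + 3 / 16) * f.coeff n := by
  have h := congrArg (fun g => coeff g n) hf
  have e : hypOp f = X * derivative (derivative f) - X * (X * derivative (derivative f)) +
      derivative f - C 2 * (X * derivative f) - C (3 / 16) * f := by
    simp only [hypOp, map_ofNat]; ring
  simp only [e] at h
  rcases n with _ | _ | n
  · simp [coeff_derivative] at h ⊢
    linear_combination h
  · simp [coeff_derivative, coeff_X_mul] at h ⊢
    linear_combination h
  · simp [coeff_derivative, coeff_X_mul] at h ⊢
    linear_combination h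

theorem eq_zero_of_hypOp_eq_zero {f : (ZMod p)[X]} (hf : hypOp f = 0)
    (hd : f.natDegree < p) (h0 : f.coeff 0 = 0) : f = 0 := by
  have key : ∀ n, n < p → f.coeff n = 0 := by
    intro n
    induction n with
    | zero => exact fun _ => h0
    | succ n ih =>
      intro hn
      have h := coeff_succ_of_hypOp_eq_zero hf n
      rw [ih (by omega), mul_zero] at h
      have hne : ((n : ZMod p) + 1) ≠ 0 := by
        have : ((n + 1 : ℕ) : ZMod p) ≠ 0 := by
          rw [Ne, ZMod.natCast_eq_zero_iff]
          exact fun hdvd => absurd (Nat.le_of_dvd (by omega) hdvd) (by omega)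
        exact_mod_cast this
      simpa [hne] using h
  ext n
  rcases lt_or_ge n p with hn | hn
  · simpa using key n hn
  · simpa using coeff_eq_zero_of_natDegree_lt (by omega : f.natDegree < n)

theorem proportional_of_hypOp_eq_zero {f g : (ZMod p)[X]} (hf : hypOp f = 0) (hg : hypOp g = 0)
    (hdf : f.natDegree < p) (hdg : g.natDegree < p) :
    C (g.coeff 0) * f = C (f.coeff 0) * g := by
  refine sub_eq_zero.mp (eq_zero_of_hypOp_eq_zero p ?_ ?_ ?_)
  · rw [hypOp_linear, hf, hg]; simp
  · refine lt_of_le_of_lt (natDegree_sub_le _ _) (max_lt ?_ ?_)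
    · exact lt_of_le_of_lt (natDegree_C_mul_le _ _) hdf
    · exact lt_of_le_of_lt (natDegree_C_mul_le _ _) hdg
  · simp [mul_comm]

theorem hypOp_comp_one_sub {F : Type*} [Field F] (f : F[X]) :
    hypOp (f.comp (1 - X)) = (hypOp f).comp (1 - X) := by
  simp only [hypOp, derivative_comp, derivative_sub, derivative_one, derivative_X, derivative_mul,
    sub_comp, add_comp, mul_comp, X_comp, one_comp, C_comp, ofNat_comp]
  simp
  ring

/-- A solution of the hypergeometric equation of degree less than `p` is a multiple of its
reflection, so its set of roots is stable under `s ↦ 1 - s`. -/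
theorem aeval_one_sub_eq_zero {K : Type*} [Field K] [Algebra (ZMod p) K] {f : (ZMod p)[X]}
    (hf : hypOp f = 0) (hd : f.natDegree < p) (h0 : f.coeff 0 ≠ 0) {s : K}
    (hs : aeval s f = 0) : aeval (1 - s) f = 0 := by
  have h := proportional_of_hypOp_eq_zero p (f := f.comp (1 - X)) (g := f)
    (by rw [hypOp_comp_one_sub, hf]; simp) hf
    (by
      refine lt_of_le_of_lt natDegree_comp_le ?_
      have : (1 - X : (ZMod p)[X]).natDegree ≤ 1 := by compute_degree
      nlinarith) hd
  have h' := congrArg (aeval s) h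
  simp only [map_mul, aeval_C, aeval_comp, hs, mul_zero] at h'
  simpa [h0] using h'

theorem legendreSym_neg_three (hp : 5 ≤ p) : legendreSym p (-3) = if p % 3 = 1 then 1 else -1 := by
  have : Fact (Nat.Prime 3) := ⟨Nat.prime_three⟩
  have hodd : p % 2 = 1 := ((Fact.out : p.Prime).eq_two_or_odd).resolve_left (by omega)
  have h3 : p % 3 = 1 ∨ p % 3 = 2 := by
    have : ¬ 3 ∣ p := fun h => by
      have := (Nat.prime_dvd_prime_iff_eq Nat.prime_three (Fact.out : p.Prime)).mp h
      omega
    omega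
  have e : legendreSym p (-3) = legendreSym p (-1) * legendreSym p (3 : ℕ) := by
    rw [← legendreSym.mul]; norm_num
  rw [e, legendreSym.quadratic_reciprocity' (p := 3) (q := p) (by norm_num) (by omega),
    legendreSym.at_neg_one (by omega), ZMod.χ₄_eq_neg_one_pow hodd, ← mul_assoc, ← pow_add,
    show p / 2 + 3 / 2 * (p / 2) = 2 * (p / 2) by omega, pow_mul, legendreSym.mod]
  have h3' : ((p : ℤ) % (3 : ℕ)) = ((p % 3 : ℕ) : ℤ) := by push_cast; rfl
  rw [h3']
  rcases h3 with h | h <;> rw [h]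
  · simp
  · norm_num

theorem eps_eq (hp : 5 ≤ p) : eps p = if p % 4 = 1 then 0 else 1 := by
  have hodd : p % 2 = 1 := ((Fact.out : p.Prime).eq_two_or_odd).resolve_left (by omega)
  rw [eps, legendreSym.at_neg_one (by omega), ZMod.χ₄_nat_eq_if_mod_four]
  split_ifs <;> omega

theorem del_eq (hp : 5 ≤ p) : del p = if p % 3 = 1 then 0 else 1 := by
  rw [del, legendreSym_neg_three p hp]
  split_ifs <;> rfl

theorem eps_le_one (hp : 5 ≤ p) : eps p ≤ 1 := by
  rw [eps_eq p hp]; split_ifs <;> simp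

theorem twelve_mul_div_add (hp : 5 ≤ p) : 12 * (p / 12) + 1 + 4 * del p + 6 * eps p = p := by
  have hodd : p % 2 = 1 := ((Fact.out : p.Prime).eq_two_or_odd).resolve_left (by omega)
  have h3 : ¬ 3 ∣ p := fun h => by
    have := (Nat.prime_dvd_prime_iff_eq Nat.prime_three (Fact.out : p.Prime)).mp h
    omega
  rw [eps_eq p hp, del_eq p hp]
  split_ifs <;> omega

theorem two_ne_zero_of_five_le (hp : 5 ≤ p) : (2 : ZMod p) ≠ 0 := by
  have : ((2 : ℕ) : ZMod p) ≠ 0 := by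
    rw [Ne, ZMod.natCast_eq_zero_iff]
    exact fun h => absurd (Nat.le_of_dvd (by norm_num) h) (by omega)
  exact_mod_cast this

theorem three_ne_zero_of_five_le (hp : 5 ≤ p) : (3 : ZMod p) ≠ 0 := by
  have : ((3 : ℕ) : ZMod p) ≠ 0 := by
    rw [Ne, ZMod.natCast_eq_zero_iff]
    exact fun h => absurd (Nat.le_of_dvd (by norm_num) h) (by omega)
  exact_mod_cast this

theorem twelve_ne_zero_of_five_le (hp : 5 ≤ p) : (12 : ZMod p) ≠ 0 := by
  have h2 := two_ne_zero_of_five_le p hp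
  have h3 := three_ne_zero_of_five_le p hp
  rw [show (12 : ZMod p) = 2 ^ 2 * 3 by norm_num]
  positivity

/-- The coefficients of the truncated hypergeometric series in Deuring's formula. -/
def ssCoeff (n : ℕ) : ZMod p :=
  poch p (-(p / 12 : ℕ) : ZMod p) n *
    poch p ((5 : ZMod p) / 12 - (((2 * (del p : ℤ) - 3 * (eps p : ℤ)) : ℤ) : ZMod p) / 6) n /
    ((n.factorial : ZMod p)) ^ 2

theorem ssCoeff_zero : ssCoeff p 0 = 1 := by simp [ssCoeff, poch]

theorem succ_ne_zero_of_lt {n : ℕ} (hn : n + 1 < p) : ((n : ZMod p) + 1) ≠ 0 := by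
  have : ((n + 1 : ℕ) : ZMod p) ≠ 0 := by
    rw [Ne, ZMod.natCast_eq_zero_iff]
    exact fun hdvd => absurd (Nat.le_of_dvd (by omega) hdvd) (by omega)
  exact_mod_cast this

theorem ssCoeff_succ (hp : 5 ≤ p) {n : ℕ} (hn : n + 1 < p) :
    12 * ((n : ZMod p) + 1) ^ 2 * ssCoeff p (n + 1) =
      (n - (p / 12 : ℕ)) * (12 * n + 5 - 4 * del p + 6 * eps p) * ssCoeff p n := by
  have h1 := succ_ne_zero_of_lt p hn
  have h2 : ((n.factorial : ℕ) : ZMod p) ≠ 0 := by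
    rw [Ne, ZMod.natCast_eq_zero_iff, (Fact.out : p.Prime).dvd_factorial]
    omega
  have h12 := twelve_ne_zero_of_five_le p hp
  have h6 : (6 : ZMod p) ≠ 0 := fun h => h12 (by linear_combination 2 * h)
  simp only [ssCoeff, poch, ascPochhammer_succ_eval, Nat.factorial_succ]
  push_cast
  field_simp
  rw [show (12 : ZMod p) = 2 * 6 by norm_num]
  ring

theorem ssCoeff_succ' (hp : 5 ≤ p) {n : ℕ} (hn : n + 1 < p) :
    144 * ((n : ZMod p) + 1) ^ 2 * ssCoeff p (n + 1) =
      (144 * n ^ 2 + 72 * n + 144 * n * eps p + 5 + 72 * eps p) * ssCoeff p n := by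
  have h := ssCoeff_succ p hp hn
  have hm : (12 : ZMod p) * (p / 12 : ℕ) + 1 + 4 * del p + 6 * eps p = 0 := by
    have := congrArg (Nat.cast : ℕ → ZMod p) (twelve_mul_div_add p hp)
    push_cast at this
    simpa using this
  have he : (eps p : ZMod p) ^ 2 = eps p := by
    rw [eps_eq p hp]; split_ifs <;> simp
  have hd : (del p : ZMod p) ^ 2 = del p := by
    rw [del_eq p hp]; split_ifs <;> simp
  linear_combination 12 * h - (12 * n + 5 - 4 * del p + 6 * eps p) * ssCoeff p n * hm +
    36 * ssCoeff p n * he - 16 * ssCoeff p n * hd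

theorem mul_derivative_pow_self {R : Type*} [CommRing R] (f : R[X]) (n : ℕ) :
    f * derivative (f ^ n) = n * f ^ n * derivative f := by
  rcases n with _ | n
  · simp
  · rw [derivative_pow_succ]
    simp only [map_add, map_natCast, map_one]
    push_cast
    ring

/-- The basis `(27s²(1-s))^k (4-3s)^j (8-9s)^i` in which the pullback of the supersingular
polynomial to the modular curve `X₀(2)` is expanded. -/
def hauptTerm (F : Type*) [Field F] (k j i : ℕ) : F[X] :=
  (27 * X ^ 2 * (1 - X)) ^ k * (4 - 3 * X) ^ j * (8 - 9 * X) ^ i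

theorem derivative_hauptTerm {F : Type*} [Field F] (k j i : ℕ) :
    X * (1 - X) * (4 - 3 * X) * (8 - 9 * X) * derivative (hauptTerm F k j i) =
      ((k : F[X]) * (2 - 3 * X) * (4 - 3 * X) * (8 - 9 * X)
        - 3 * (j : F[X]) * X * (1 - X) * (8 - 9 * X)
        - 9 * (i : F[X]) * X * (1 - X) * (4 - 3 * X)) * hauptTerm F k j i := by
  have h1 : X * (1 - X) * derivative ((27 * X ^ 2 * (1 - X) : F[X]) ^ k) =
      (k : F[X]) * (2 - 3 * X) * (27 * X ^ 2 * (1 - X) : F[X]) ^ k := by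
    have hd : derivative (27 * X ^ 2 * (1 - X) : F[X]) = 27 * X * (2 - 3 * X) := by
      simp only [derivative_mul, derivative_sub, derivative_one, derivative_X, derivative_ofNat,
        derivative_X_sq, map_ofNat]
      ring
    rcases k with _ | k
    · simp
    · rw [derivative_pow_succ, hd]
      simp only [map_add, map_natCast, map_one]
      push_cast
      ring
  have h2 := mul_derivative_pow_self (4 - 3 * X : F[X]) j
  have h3 := mul_derivative_pow_self (8 - 9 * X : F[X]) i
  have d2 : derivative (4 - 3 * X : F[X]) = -3 := by simp [derivative_mul]
  have d3 : derivative (8 - 9 * X : F[X]) = -9 := by simp [derivative_mul]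
  rw [d2] at h2
  rw [d3] at h3
  rw [hauptTerm, derivative_mul, derivative_mul]
  linear_combination (4 - 3 * X) * (8 - 9 * X) * (4 - 3 * X) ^ j * (8 - 9 * X) ^ i * h1 +
    X * (1 - X) * (8 - 9 * X) * (27 * X ^ 2 * (1 - X)) ^ k * (8 - 9 * X) ^ i * h2 +
    X * (1 - X) * (4 - 3 * X) * (27 * X ^ 2 * (1 - X)) ^ k * (4 - 3 * X) ^ j * h3

theorem hypOp_hauptTerm {F : Type*} [Field F] (h2 : (2 : F) ≠ 0) {k j i : ℕ} (hi : i ≤ 1)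
    (hj : (4 * j + 1 + 6 * i + 12 * k : F) = 0) :
    144 * (X * (1 - X) * (4 - 3 * X) * (8 - 9 * X)) ^ 2 * hypOp (hauptTerm F k j i) =
      (8 - 9 * X) ^ 2 * X * (1 - X) * (144 * (k : F[X]) ^ 2 * (4 - 3 * X) ^ 3 -
        27 * X ^ 2 * (1 - X) * (144 * (k : F[X]) ^ 2 + 72 * (k : F[X]) + 144 * (k : F[X]) * (i : F[X]) + 5 + 72 * (i : F[X]))) *
        hauptTerm F k j i := by
  have hj' : 4 * (j : F[X]) + 1 + 6 * (i : F[X]) + 12 * (k : F[X]) = 0 := by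
    have := congrArg (C : F → F[X]) hj
    simpa only [map_add, map_mul, map_ofNat, map_natCast, map_one, map_zero] using this
  have hc : 16 * C (3 / 16 : F) = 3 := by
    rw [show (16 : F[X]) = C 16 from (map_ofNat C 16).symm, ← C_mul, mul_div_cancel₀]
    · exact map_ofNat C 3
    · rw [show (16 : F) = 2 ^ 4 by norm_num]; positivity
  set E := hauptTerm F k j i with hE
  set W : F[X] := X * (1 - X) * (4 - 3 * X) * (8 - 9 * X) with hW
  set A : F[X] := 4 * (k : F[X]) * (2 - 3 * X) * (4 - 3 * X) * (8 - 9 * X)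
    + 3 * (1 + 6 * (i : F[X]) + 12 * (k : F[X])) * X * (1 - X) * (8 - 9 * X)
    - 36 * (i : F[X]) * X * (1 - X) * (4 - 3 * X) with hA
  have h : 4 * (W * derivative E) = A * E := by
    have := derivative_hauptTerm (F := F) k j i
    rw [hW, hA, this]
    linear_combination (-3 * X * (1 - X) * (8 - 9 * X)) * E * hj'
  have hd := congrArg derivative h
  have dW : derivative W = (1 - 2 * X) * (4 - 3 * X) * (8 - 9 * X)
      - 3 * X * (1 - X) * (8 - 9 * X) - 9 * X * (1 - X) * (4 - 3 * X) := by
    simp [hW, derivative_mul]; ring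
  have dA : derivative A = 4 * (k : F[X]) * (-3 * (4 - 3 * X) * (8 - 9 * X) - 3 * (2 - 3 * X) * (8 - 9 * X)
        - 9 * (2 - 3 * X) * (4 - 3 * X))
      + 3 * (1 + 6 * (i : F[X]) + 12 * (k : F[X])) * ((1 - 2 * X) * (8 - 9 * X) - 9 * X * (1 - X))
      - 36 * (i : F[X]) * ((1 - 2 * X) * (4 - 3 * X) - 3 * X * (1 - X)) := by
    simp [hA, derivative_mul]; ring
  simp only [derivative_mul, dW, dA, derivative_ofNat, zero_mul, zero_add] at hd
  have h16 : 16 * W ^ 2 * derivative (derivative E) =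
      (4 * derivative A * W + A ^ 2 - 4 * derivative W * A) * E := by
    rw [dA, dW]
    linear_combination 4 * W * hd + (A - 4 * ((1 - 2 * X) * (4 - 3 * X) * (8 - 9 * X)
      - 3 * X * (1 - X) * (8 - 9 * X) - 9 * X * (1 - X) * (4 - 3 * X))) * h
  have key : 144 * W ^ 2 * hypOp E = (9 * X * (1 - X) *
      (4 * derivative A * W + A ^ 2 - 4 * derivative W * A)
      + 36 * (1 - 2 * X) * W * A - 27 * W ^ 2) * E := by
    rw [hypOp]
    linear_combination 9 * X * (1 - X) * h16 + 36 * (1 - 2 * X) * W * h - 9 * W ^ 2 * E * hc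
  rw [key, dA, dW, hA, hW]
  clear_value E
  clear hA hW key h16 hd h hj hj' dW dA A W
  refine congrArg (· * E) ?_
  rcases Nat.le_one_iff_eq_zero_or_eq_one.mp hi with rfl | rfl
  · simp only [Nat.cast_zero]; ring
  · simp only [Nat.cast_one]; ring

/-- The pullback of the supersingular polynomial to `X₀(2)`, stripped of its multiple roots
above `0` and `1728`. -/
def ssPullback : (ZMod p)[X] :=
  ∑ k ∈ Finset.range (p / 12 + 1),
    C (ssCoeff p k) * hauptTerm (ZMod p) k (3 * (p / 12 - k) + del p) (eps p)

theorem hypOp_sum {F ι : Type*} [Field F] (s : Finset ι) (c : ι → F) (f : ι → F[X]) :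
    hypOp (∑ k ∈ s, C (c k) * f k) = ∑ k ∈ s, C (c k) * hypOp (f k) := by
  simp only [hypOp, derivative_sum, derivative_C_mul, Finset.mul_sum, ← Finset.sum_add_distrib,
    ← Finset.sum_sub_distrib]
  refine Finset.sum_congr rfl fun k _ => ?_
  ring

theorem ssCoeff_eq_zero (hp : 5 ≤ p) : ssCoeff p (p / 12 + 1) = 0 := by
  have hlt : p / 12 + 1 < p := by omega
  have h := ssCoeff_succ p hp hlt
  rw [sub_self, zero_mul, zero_mul] at h
  simpa [succ_ne_zero_of_lt p hlt, twelve_ne_zero_of_five_le p hp] using h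

theorem hypOp_ssPullback (hp : 5 ≤ p) : hypOp (ssPullback p) = 0 := by
  set m := p / 12 with hm
  have hmp : m + 1 < p := by omega
  set W : (ZMod p)[X] := X * (1 - X) * (4 - 3 * X) * (8 - 9 * X) with hW
  have h2 := two_ne_zero_of_five_le p hp
  have h12 := twelve_ne_zero_of_five_le p hp
  have h0 : eval 0 (144 * (4 - 3 * X) ^ 2 * (8 - 9 * X) ^ 2 : (ZMod p)[X]) ≠ 0 := by
    rw [show eval 0 (144 * (4 - 3 * X) ^ 2 * (8 - 9 * X) ^ 2 : (ZMod p)[X]) = 12 ^ 2 * 2 ^ 10 by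
      simp; norm_num]
    positivity
  have hW0 : (144 * W ^ 2 : (ZMod p)[X]) ≠ 0 := by
    have hX1 : (1 - X : (ZMod p)[X]) ≠ 0 := fun h => by
      have := congrArg (eval 0) h
      simp at this
    have hq : (144 * (4 - 3 * X) ^ 2 * (8 - 9 * X) ^ 2 : (ZMod p)[X]) ≠ 0 := fun h => by
      rw [h] at h0; simp at h0
    rw [show 144 * W ^ 2 = (X * (1 - X)) ^ 2 * (144 * (4 - 3 * X) ^ 2 * (8 - 9 * X) ^ 2) by
      rw [hW]; ring]
    exact mul_ne_zero (pow_ne_zero _ (mul_ne_zero X_ne_zero hX1)) hq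
  set t : ℕ → (ZMod p)[X] := fun k => (8 - 9 * X) ^ 2 * X * (1 - X) * (4 - 3 * X) ^ 3 *
    (144 * (k : (ZMod p)[X]) ^ 2 * (C (ssCoeff p k) *
      hauptTerm (ZMod p) k (3 * (m - k) + del p) (eps p))) with ht
  have hterm : ∀ k ∈ Finset.range (m + 1), 144 * W ^ 2 * (C (ssCoeff p k) *
      hypOp (hauptTerm (ZMod p) k (3 * (m - k) + del p) (eps p))) = -(t (k + 1) - t k) := by
    intro k hk
    have hkm : k ≤ m := by simpa [Nat.lt_succ_iff] using hk
    have hj : (4 * ((3 * (m - k) + del p : ℕ) : ZMod p) + 1 + 6 * (eps p : ℕ) + 12 * (k : ℕ)) =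
        0 := by
      have := congrArg (Nat.cast : ℕ → ZMod p)
        (show 4 * (3 * (m - k) + del p) + 1 + 6 * eps p + 12 * k = p by
          have := twelve_mul_div_add p hp; omega)
      simpa using this
    have h := hypOp_hauptTerm h2 (eps_le_one p hp) hj
    have hs := congrArg (C : ZMod p → (ZMod p)[X])
      (ssCoeff_succ' p hp (show k + 1 < p by omega))
    simp only [map_mul, map_add, map_pow, map_natCast, map_ofNat, map_one] at hs
    have hb : 27 * X ^ 2 * (1 - X) * (C (ssCoeff p (k + 1)) *
        hauptTerm (ZMod p) k (3 * (m - k) + del p) (eps p)) = (4 - 3 * X) ^ 3 *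
        (C (ssCoeff p (k + 1)) *
          hauptTerm (ZMod p) (k + 1) (3 * (m - (k + 1)) + del p) (eps p)) := by
      rcases hkm.eq_or_lt with rfl | hlt
      · rw [ssCoeff_eq_zero p hp]; simp
      · rw [hauptTerm, hauptTerm, show 3 * (m - k) + del p = 3 * (m - (k + 1)) + del p + 3 by omega]
        ring
    simp only [ht]
    push_cast
    linear_combination C (ssCoeff p k) * h - (8 - 9 * X) ^ 2 * X * (1 - X) *
      (144 * ((k : (ZMod p)[X]) + 1) ^ 2) * hb + (8 - 9 * X) ^ 2 * X * (1 - X) *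
      27 * X ^ 2 * (1 - X) * hauptTerm (ZMod p) k (3 * (m - k) + del p) (eps p) * hs
  have hsum : 144 * W ^ 2 * hypOp (ssPullback p) = 0 := by
    rw [ssPullback, hypOp_sum, Finset.mul_sum, Finset.sum_congr rfl hterm,
      Finset.sum_neg_distrib, Finset.sum_range_sub]
    simp [ht, hm, ssCoeff_eq_zero p hp]
  exact (mul_eq_zero.mp hsum).resolve_left hW0

theorem natDegree_ssPullback_lt (hp : 5 ≤ p) : (ssPullback p).natDegree < p := by
  have hle : (ssPullback p).natDegree ≤ 3 * (p / 12) + del p + eps p := by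
    refine natDegree_sum_le_of_forall_le _ _ fun k hk => ?_
    have hkm : k ≤ p / 12 := by simpa [Nat.lt_succ_iff] using hk
    refine (natDegree_C_mul_le _ _).trans ?_
    have h1 : (27 * X ^ 2 * (1 - X) : (ZMod p)[X]).natDegree ≤ 3 := by compute_degree
    have h2 : (4 - 3 * X : (ZMod p)[X]).natDegree ≤ 1 := by compute_degree
    have h3 : (8 - 9 * X : (ZMod p)[X]).natDegree ≤ 1 := by compute_degree
    refine (natDegree_mul_le_of_le (natDegree_mul_le_of_le (natDegree_pow_le_of_le k h1)
      (natDegree_pow_le_of_le _ h2)) (natDegree_pow_le_of_le _ h3)).trans ?_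
    omega
  have := twelve_mul_div_add p hp
  omega

theorem coeff_zero_ssPullback_ne_zero (hp : 5 ≤ p) : (ssPullback p).coeff 0 ≠ 0 := by
  have h2 := two_ne_zero_of_five_le p hp
  rw [coeff_zero_eq_eval_zero, ssPullback, eval_finsetSum, Finset.sum_eq_single 0]
  · simp only [hauptTerm, ssCoeff_zero, eval_mul, eval_pow, eval_sub, eval_ofNat, eval_X, eval_C]
    rw [show (4 - 3 * 0 : ZMod p) = 2 ^ 2 by norm_num, show (8 - 9 * 0 : ZMod p) = 2 ^ 3 by norm_num]
    simp [h2]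
  · intro k _ hk
    simp [hauptTerm, hk]
  · simp

/-- The `j`-invariant of `y² = x(x² + x + s/4)`, as a function on `X₀(2)`; the quotient by the
`2`-torsion point `(0, 0)` has parameter `1 - s`. -/
def jInv {K : Type*} [Field K] (s : K) : K := 64 * (4 - 3 * s) ^ 3 / (s ^ 2 * (1 - s))

/-- The polynomial whose roots are the `j`-invariants `0`, `1728`, and those of discriminant
`-7` and `-15`. -/
def specialJ {R : Type*} [CommRing R] (x : R) : R :=
  x * (x - 1728) * (x + 3375) * (x ^ 2 + 191025 * x - 121287375)

theorem map_jInv {K L : Type*} [Field K] [Field L] (f : K →+* L) (s : K) :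
    f (jInv s) = jInv (f s) := by
  simp [jInv, map_ofNat]

theorem map_specialJ {R S : Type*} [CommRing R] [CommRing S] (f : R →+* S) (x : R) :
    f (specialJ x) = specialJ (f x) := by
  simp [specialJ, map_ofNat]

theorem jInv_sub_1728 {K : Type*} [Field K] {s : K} (h0 : s ≠ 0) (h1 : s ≠ 1) :
    jInv s - 1728 = 64 * (8 - 9 * s) ^ 2 / (s ^ 2 * (1 - s)) := by
  have h1' : 1 - s ≠ 0 := sub_ne_zero.mpr h1.symm
  rw [jInv]
  field_simp
  ring

/-- A pair of distinct `2`-isogenies with the same source and target curve exists only for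
finitely many `j`-invariants. -/
theorem specialJ_eq_zero_of_jInv_eq {K : Type*} [Field K] {s t : K} (hst : s ≠ t)
    (hs0 : s ≠ 0) (hs1 : s ≠ 1) (ht0 : t ≠ 0) (ht1 : t ≠ 1) (h : jInv s = jInv t)
    (h' : jInv (1 - s) = jInv (1 - t)) (h64 : (64 : K) ≠ 0) : specialJ (jInv s) = 0 := by
  have hs1' : 1 - s ≠ 0 := sub_ne_zero.mpr hs1.symm
  have ht1' : 1 - t ≠ 0 := sub_ne_zero.mpr ht1.symm
  have hst' : s - t ≠ 0 := sub_ne_zero.mpr hst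
  rw [jInv, jInv, div_eq_div_iff (by simp [*]) (by simp [*])] at h h'
  have P1 : 64 * (s + t) ^ 2 - 144 * (s + t) * (s * t) - 64 * (s + t) + 81 * (s * t) ^ 2 +
      80 * (s * t) = 0 := by
    refine (mul_eq_zero.mp (?_ : 64 * (s - t) * _ = 0)).resolve_left (mul_ne_zero h64 hst')
    linear_combination h
  have P2 : -1 + 46 * (s * t) - 81 * (s * t) ^ 2 + 2 * (s + t) + 18 * (s + t) * (s * t) -
      (s + t) ^ 2 = 0 := by
    refine (mul_eq_zero.mp (?_ : 64 * (s - t) * _ = 0)).resolve_left (mul_ne_zero h64 hst')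
    linear_combination h'
  have hsplit : (s + t - 1) * (63 * (s + t) + 1 - 126 * (s * t)) = 0 := by
    linear_combination P1 + P2
  have hQ : s ^ 2 * (1 - s) ≠ 0 := by simp [*]
  rcases mul_eq_zero.mp hsplit with he | he
  · have ht : t = 1 - s := by linear_combination he
    subst ht
    have hq : 81 * s ^ 2 - 81 * s + 64 = 0 := by
      refine (mul_eq_zero.mp (?_ : s * (1 - s) * _ = 0)).resolve_left (by simp [*])
      linear_combination -P1
    have : jInv s + 3375 = 0 := by
      rw [jInv, div_add' _ _ _ hQ, div_eq_zero_iff]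
      left
      linear_combination (64 - 63 * s) * hq
    rw [specialJ, this]; ring
  · have hE : 63 * (2 * s - 1) * (s + t) = 126 * s ^ 2 + 1 := by linear_combination -he
    have hM : 4096 - 13248 * s + 207729 * s ^ 2 - 388962 * s ^ 3 + 194481 * s ^ 4 = 0 := by
      linear_combination (63 * (2 * s - 1)) ^ 2 * P1 -
        ((81 * s ^ 2 - 144 * s + 64) * (126 * s ^ 2 + 1 + 63 * (2 * s - 1) * (s + t)) +
        (80 * s - 162 * s ^ 3 - 64 + 144 * s ^ 2) * (63 * (2 * s - 1))) * hE
    have : jInv s ^ 2 + 191025 * jInv s - 121287375 = 0 := by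
      rw [jInv]
      field_simp
      linear_combination (4096 - 5184 * s + 1089 * s ^ 2) * hM
    rw [specialJ, this]; ring

/-- Relation between the supersingular polynomial and its pullback to `X₀(2)`. -/
theorem aeval_jInv_ssPoly {K : Type*} [Field K] [Algebra (ZMod p) K] {s : K}
    (h0 : s ≠ 0) (h1 : s ≠ 1) :
    (s ^ 2 * (1 - s)) ^ (p / 12 + del p + eps p) * aeval (jInv s) (ssPoly p) =
      64 ^ (p / 12 + del p + eps p) * (8 - 9 * s) ^ eps p * (4 - 3 * s) ^ (2 * del p) *
        aeval s (ssPullback p) := by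
  have h1' : 1 - s ≠ 0 := sub_ne_zero.mpr h1.symm
  have hQ : s ^ 2 * (1 - s) ≠ 0 := by simp [*]
  have hj : s ^ 2 * (1 - s) * jInv s = 64 * (4 - 3 * s) ^ 3 := by
    rw [jInv, mul_div_cancel₀ _ hQ]
  have hj' : s ^ 2 * (1 - s) * (jInv s - 1728) = 64 * (8 - 9 * s) ^ 2 := by
    rw [jInv_sub_1728 h0 h1, mul_div_cancel₀ _ hQ]
  have hss : aeval (jInv s) (ssPoly p) = (jInv s - 1728) ^ eps p *
      ∑ n ∈ Finset.range (p / 12 + 1), algebraMap (ZMod p) K (ssCoeff p n) * 1728 ^ n *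
        jInv s ^ (p / 12 + del p - n) := by
    simp [ssPoly, ssCoeff, map_ofNat]
  have hterm : (s ^ 2 * (1 - s)) ^ (p / 12 + del p) *
      ∑ n ∈ Finset.range (p / 12 + 1), algebraMap (ZMod p) K (ssCoeff p n) * 1728 ^ n *
        jInv s ^ (p / 12 + del p - n) =
      64 ^ (p / 12 + del p) * (4 - 3 * s) ^ (2 * del p) *
      ∑ n ∈ Finset.range (p / 12 + 1), algebraMap (ZMod p) K (ssCoeff p n) *
        ((27 * s ^ 2 * (1 - s)) ^ n * (4 - 3 * s) ^ (3 * (p / 12 - n) + del p)) := by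
    rw [Finset.mul_sum, Finset.mul_sum]
    refine Finset.sum_congr rfl fun n hn => ?_
    obtain ⟨r, hr⟩ : ∃ r, p / 12 = n + r :=
      Nat.exists_eq_add_of_le (Nat.lt_succ_iff.mp (Finset.mem_range.mp hn))
    rw [hr, show n + r + del p - n = r + del p by omega, show n + r - n = r by omega]
    calc _ = algebraMap (ZMod p) K (ssCoeff p n) * (1728 * (s ^ 2 * (1 - s))) ^ n *
          (s ^ 2 * (1 - s) * jInv s) ^ (r + del p) := by
          rw [mul_pow _ (jInv s), mul_pow (1728 : K), add_assoc, pow_add _ n]; ring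
      _ = _ := by
          rw [hj, show (1728 : K) * (s ^ 2 * (1 - s)) = 64 * (27 * s ^ 2 * (1 - s)) by ring]
          generalize 27 * s ^ 2 * (1 - s) = q
          generalize 4 - 3 * s = u
          rw [mul_pow, mul_pow]
          ring
  have heval : aeval s (ssPullback p) = (8 - 9 * s) ^ eps p *
      ∑ n ∈ Finset.range (p / 12 + 1), algebraMap (ZMod p) K (ssCoeff p n) *
        ((27 * s ^ 2 * (1 - s)) ^ n * (4 - 3 * s) ^ (3 * (p / 12 - n) + del p)) := by
    rw [ssPullback, map_sum, Finset.mul_sum]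
    refine Finset.sum_congr rfl fun n _ => ?_
    simp only [hauptTerm, map_mul, map_pow, map_sub, aeval_C, aeval_X, map_ofNat, map_one]
    ring
  calc _ = ((s ^ 2 * (1 - s)) * (jInv s - 1728)) ^ eps p * ((s ^ 2 * (1 - s)) ^ (p / 12 + del p) *
        ∑ n ∈ Finset.range (p / 12 + 1), algebraMap (ZMod p) K (ssCoeff p n) * 1728 ^ n *
        jInv s ^ (p / 12 + del p - n)) := by
        rw [hss, pow_add _ (p / 12 + del p) (eps p), mul_pow _ (jInv s - 1728)]; ring
    _ = _ := by
        rw [hterm, hj', heval, mul_pow 64, ← pow_mul, pow_add 64 (p / 12 + del p)]; ring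

theorem ssPoly_eq :
    ssPoly p = (X - C 1728) ^ eps p * ∑ n ∈ Finset.range (p / 12 + 1),
      C (ssCoeff p n * 1728 ^ n) * X ^ (p / 12 + del p - n) := rfl

theorem monic_natDegree_ssPoly :
    (ssPoly p).Monic ∧ (ssPoly p).natDegree = p / 12 + del p + eps p := by
  have hdeg : (∑ n ∈ Finset.range (p / 12),
      C (ssCoeff p (n + 1) * 1728 ^ (n + 1)) * X ^ (p / 12 + del p - (n + 1)) :
        (ZMod p)[X]).degree < ((p / 12 + del p : ℕ) : WithBot ℕ) := by
    refine (degree_sum_le _ _).trans_lt ((Finset.sup_lt_iff (WithBot.bot_lt_coe _)).mpr ?_)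
    intro n hn
    refine (degree_C_mul_X_pow_le _ _).trans_lt ?_
    rw [Finset.mem_range] at hn
    exact_mod_cast (by omega : p / 12 + del p - (n + 1) < p / 12 + del p)
  have hlin : ((X - C 1728 : (ZMod p)[X]) ^ eps p).Monic := (monic_X_sub_C _).pow _
  have hsum : (∑ n ∈ Finset.range (p / 12 + 1),
      C (ssCoeff p n * 1728 ^ n) * X ^ (p / 12 + del p - n) : (ZMod p)[X]) =
      X ^ (p / 12 + del p) + ∑ n ∈ Finset.range (p / 12),
        C (ssCoeff p (n + 1) * 1728 ^ (n + 1)) * X ^ (p / 12 + del p - (n + 1)) := by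
    rw [Finset.sum_range_succ', add_comm]
    simp [ssCoeff_zero]
  have hmon := monic_X_pow_add hdeg
  rw [ssPoly_eq, hsum]
  refine ⟨hlin.mul hmon, ?_⟩
  rw [hlin.natDegree_mul hmon, natDegree_pow, natDegree_X_sub_C, natDegree_add_eq_left_of_degree_lt,
    natDegree_X_pow]
  · ring
  · rwa [degree_X_pow]

/-- If `ss_p` has `deg ss_p` roots in `𝔽_p`, it has no other roots. -/
theorem mem_range_of_aeval_ssPoly_eq_zero (h : (ssPoly p).natDegree = LL p) {K : Type*} [Field K]
    [Algebra (ZMod p) K] {j : K} (hj : aeval j (ssPoly p) = 0) :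
    j ∈ (algebraMap (ZMod p) K).range := by
  refine Splits.mem_range_of_isRoot (f := ssPoly p) ?_ (monic_natDegree_ssPoly p).1.ne_zero ?_
  · rw [splits_iff_card_roots]
    exact le_antisymm (card_roots' _) (h.trans_le (Multiset.toFinset_card_le _))
  · rwa [IsRoot, eval_map_algebraMap]

theorem mem_range_of_pow_eq {K : Type*} [Field K] [Algebra (ZMod p) K] {x : K} (hx : x ^ p = x) :
    x ∈ (algebraMap (ZMod p) K).range := by
  have hp := (Fact.out : p.Prime)
  refine Splits.mem_range_of_isRoot (f := (X ^ p - X : (ZMod p)[X])) ?_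
    (FiniteField.X_pow_card_sub_X_ne_zero _ hp.one_lt) ?_
  · simpa [ZMod.card] using FiniteField.splits_X_pow_card_sub_X (K := ZMod p) (p := p)
  · simp [IsRoot, hx]

theorem sixtyFour_ne_zero (hp : 5 ≤ p) {K : Type*} [Field K] [Algebra (ZMod p) K] :
    (64 : K) ≠ 0 := by
  have h : (algebraMap (ZMod p) K) (2 ^ 6) ≠ 0 :=
    (_root_.map_ne_zero _).mpr (pow_ne_zero _ (two_ne_zero_of_five_le p hp))
  rw [map_pow, map_ofNat] at h
  norm_num at h ⊢
  exact h

section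

variable {K : Type*} [Field K] [Algebra (ZMod p) K]

theorem aeval_ssPullback_eq_zero (hp : 5 ≤ p) {s : K} (h0 : s ≠ 0) (h1 : s ≠ 1)
    (hj : specialJ (jInv s) ≠ 0) (h : aeval (jInv s) (ssPoly p) = 0) :
    aeval s (ssPullback p) = 0 := by
  have key := aeval_jInv_ssPoly p h0 h1
  have h64 := sixtyFour_ne_zero p hp (K := K)
  rw [h, mul_zero] at key
  refine (mul_eq_zero.mp key.symm).resolve_left (mul_ne_zero (mul_ne_zero (pow_ne_zero _ h64)
    (pow_ne_zero _ fun h8 => hj ?_)) (pow_ne_zero _ fun h4 => hj ?_))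
  · have : jInv s - 1728 = 0 := by rw [jInv_sub_1728 h0 h1, h8]; simp
    simp [specialJ, this]
  · have : jInv s = 0 := by rw [jInv, h4]; simp
    simp [specialJ, this]

theorem aeval_jInv_ssPoly_eq_zero {s : K} (h0 : s ≠ 0) (h1 : s ≠ 1)
    (h : aeval s (ssPullback p) = 0) : aeval (jInv s) (ssPoly p) = 0 := by
  have key := aeval_jInv_ssPoly p h0 h1
  rw [h, mul_zero] at key
  exact (mul_eq_zero.mp key).resolve_left
    (pow_ne_zero _ (mul_ne_zero (pow_ne_zero _ h0) (sub_ne_zero.mpr h1.symm)))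

theorem aeval_jInv_one_sub_ssPoly_eq_zero (hp : 5 ≤ p) {s : K} (h0 : s ≠ 0) (h1 : s ≠ 1)
    (hj : specialJ (jInv s) ≠ 0) (h : aeval (jInv s) (ssPoly p) = 0) :
    aeval (jInv (1 - s)) (ssPoly p) = 0 :=
  aeval_jInv_ssPoly_eq_zero p (sub_ne_zero.mpr h1.symm) (by simpa using h0)
    (aeval_one_sub_eq_zero p (hypOp_ssPullback p hp) (natDegree_ssPullback_lt p hp)
      (coeff_zero_ssPullback_ne_zero p hp) (aeval_ssPullback_eq_zero p hp h0 h1 hj h))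

/-- If all supersingular invariants are rational, so are the `2`-torsion points of a
supersingular curve with non-special invariant. -/
theorem mem_range_of_jInv (hp : 5 ≤ p) (hL : (ssPoly p).natDegree = LL p) {s : K}
    (h0 : s ≠ 0) (h1 : s ≠ 1) (hj : specialJ (jInv s) ≠ 0) (h : aeval (jInv s) (ssPoly p) = 0) :
    s ∈ (algebraMap (ZMod p) K).range := by
  have : CharP K p := charP_of_injective_algebraMap (algebraMap (ZMod p) K).injective p
  have hfix : ∀ j ∈ (algebraMap (ZMod p) K).range, frobenius K p j = j := by
    rintro _ ⟨x, rfl⟩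
    rw [frobenius_def, ← map_pow, ZMod.pow_card]
  refine mem_range_of_pow_eq p ?_
  by_contra hne
  refine hj (specialJ_eq_zero_of_jInv_eq (t := frobenius K p s) (Ne.symm hne) h0 h1 ?_ ?_ ?_ ?_
    (sixtyFour_ne_zero p hp))
  · exact (_root_.map_ne_zero _).mpr h0
  · rwa [Ne, ← map_one (frobenius K p), (frobenius K p).injective.eq_iff]
  · rw [← map_jInv, hfix _ (mem_range_of_aeval_ssPoly_eq_zero p hL h)]
  · rw [← map_one (frobenius K p), ← map_sub, ← map_jInv, map_one, hfix _
      (mem_range_of_aeval_ssPoly_eq_zero p hL (aeval_jInv_one_sub_ssPoly_eq_zero p hp h0 h1 hj h))]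

end

/-- If `1 - w²` is the parameter of one `2`-torsion point, this is the parameter of another one on
the same curve; the third one is obtained from `-w`. -/
def siblingParam {K : Type*} [Field K] (w : K) : K := 8 * w * (w - 1) / (3 * w - 1) ^ 2

theorem one_sub_siblingParam {K : Type*} [Field K] {w : K} (h : 3 * w - 1 ≠ 0) :
    1 - siblingParam w = ((w + 1) / (3 * w - 1)) ^ 2 := by
  rw [siblingParam, div_pow, sub_eq_iff_eq_add, ← add_div, eq_div_iff (pow_ne_zero 2 h)]
  ring

theorem four_sub_siblingParam {K : Type*} [Field K] {w : K} (h : 3 * w - 1 ≠ 0) :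
    4 - 3 * siblingParam w = 4 * (1 + 3 * w ^ 2) / (3 * w - 1) ^ 2 := by
  rw [siblingParam]
  field_simp
  ring

theorem jInv_siblingParam {K : Type*} [Field K] {w : K} (h64 : (64 : K) ≠ 0)
    (h : 3 * w - 1 ≠ 0) : jInv (siblingParam w) = jInv (1 - w ^ 2) := by
  rw [jInv, one_sub_siblingParam h, four_sub_siblingParam h, siblingParam, jInv]
  have h8 : (8 : K) ≠ 0 := fun h8 => h64 (by linear_combination 8 * h8)
  generalize 3 * w - 1 = d at h
  by_cases hz : w * (w - 1) * (w + 1) = 0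
  · rw [show (8 * w * (w - 1) / d ^ 2) ^ 2 * ((w + 1) / d) ^ 2 =
        (w * (w - 1) * (w + 1)) * (64 * (w * (w - 1) * (w + 1)) / d ^ 6) by ring,
      show (1 - w ^ 2) ^ 2 * (1 - (1 - w ^ 2)) = (w * (w - 1) * (w + 1)) ^ 2 by ring, hz]
    simp
  · have hz' : (1 - w ^ 2) ^ 2 * (1 - (1 - w ^ 2)) ≠ 0 := by
      rw [show (1 - w ^ 2) ^ 2 * (1 - (1 - w ^ 2)) = (w * (w - 1) * (w + 1)) ^ 2 by ring]
      exact pow_ne_zero 2 hz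
    have hden : (8 * w * (w - 1) / d ^ 2) ^ 2 * ((w + 1) / d) ^ 2 =
        64 * ((1 - w ^ 2) ^ 2 * (1 - (1 - w ^ 2))) / d ^ 6 := by
      field_simp
      ring
    rw [hden, div_pow, ← pow_mul, ← mul_div_assoc, div_div_div_cancel_right₀ (pow_ne_zero _ h),
      div_eq_div_iff (mul_ne_zero h64 hz') hz']
    ring

theorem three_mul_sub_one_ne_zero {K : Type*} [Field K] {w : K} (h0 : w ≠ 0) (h1 : 1 - w ^ 2 ≠ 0)
    (hj : specialJ (jInv (1 - w ^ 2)) ≠ 0) : 3 * w - 1 ≠ 0 := by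
  intro h
  have h8 : 8 - 9 * (1 - w ^ 2) = 0 := by linear_combination (3 * w + 1) * h
  have := jInv_sub_1728 (s := 1 - w ^ 2) h1 (by simpa using h0)
  rw [h8] at this
  simp [specialJ, this] at hj

theorem siblingParam_ne_zero {K : Type*} [Field K] {w : K} (h64 : (64 : K) ≠ 0) (h0 : w ≠ 0)
    (h1 : w ≠ 1) (h : 3 * w - 1 ≠ 0) : siblingParam w ≠ 0 := by
  have h8 : (8 : K) ≠ 0 := fun h8 => h64 (by linear_combination 8 * h8)
  exact div_ne_zero (mul_ne_zero (mul_ne_zero h8 h0) (sub_ne_zero.mpr h1)) (pow_ne_zero _ h)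

theorem siblingParam_ne_one {K : Type*} [Field K] {w : K} (h1 : w ≠ -1) (h : 3 * w - 1 ≠ 0) :
    siblingParam w ≠ 1 := by
  have : 1 - siblingParam w ≠ 0 := by
    rw [one_sub_siblingParam h]
    exact pow_ne_zero _ (div_ne_zero (fun h => h1 (eq_neg_of_add_eq_zero_left h)) h)
  exact (sub_ne_zero.mp this).symm

section

variable {K : Type*} [Field K] [Algebra (ZMod p) K]

theorem mem_range_of_jInv_one_sub_sq (hp : 5 ≤ p) (hL : (ssPoly p).natDegree = LL p) {w : K}
    (h0 : w ≠ 0) (h1 : 1 - w ^ 2 ≠ 0) (hj : specialJ (jInv (1 - w ^ 2)) ≠ 0)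
    (h : aeval (jInv (1 - w ^ 2)) (ssPoly p) = 0) : w ∈ (algebraMap (ZMod p) K).range := by
  have h64 := sixtyFour_ne_zero p hp (K := K)
  have h3 := three_mul_sub_one_ne_zero h0 h1 hj
  have hw1 : w ≠ 1 := by rintro rfl; simp at h1
  have hw2 : w ≠ -1 := by rintro rfl; simp at h1
  have hs := mem_range_of_jInv p hp hL h1 (by simpa using h0) hj h
  rw [← jInv_siblingParam h64 h3] at h hj
  have ht := mem_range_of_jInv p hp hL (siblingParam_ne_zero h64 h0 hw1 h3)
    (siblingParam_ne_one hw2 h3) hj h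
  obtain ⟨a, ha⟩ := hs
  obtain ⟨b, hb⟩ := ht
  have h4 : 8 - 6 * siblingParam w ≠ 0 := by
    intro h8
    have h4 : 4 - 3 * siblingParam w = 0 := by
      refine (mul_eq_zero.mp (?_ : 64 * _ = (0 : K))).resolve_left h64
      linear_combination 32 * h8
    apply hj
    rw [jInv, h4]
    simp [specialJ]
  refine ⟨-(b + (9 * b - 8) * (1 - a)) / (8 - 6 * b), ?_⟩
  simp only [map_div₀, map_neg, map_add, map_sub, map_mul, map_ofNat, map_one, ha, hb]
  rw [div_eq_iff h4]
  have hmul : siblingParam w * (3 * w - 1) ^ 2 = 8 * w * (w - 1) :=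
    div_mul_cancel₀ _ (pow_ne_zero 2 h3)
  linear_combination -hmul

end

/-- Square root of `1 - s` over `𝔽_p` for a supersingular curve with parameter `s`. -/
theorem exists_jInv_one_sub_sq_eq (hp : 5 ≤ p) (hL : (ssPoly p).natDegree = LL p) {j : ZMod p}
    (hj : specialJ j ≠ 0) (h : (ssPoly p).eval j = 0) :
    ∃ w : ZMod p, w ≠ 0 ∧ 1 - w ^ 2 ≠ 0 ∧ jInv (1 - w ^ 2) = j := by
  let K := AlgebraicClosure (ZMod p)
  let φ := algebraMap (ZMod p) K
  have h64 := sixtyFour_ne_zero p hp (K := K)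
  have hj1728 : φ j - 1728 ≠ 0 := by
    have : φ (j - 1728) ≠ 0 := (_root_.map_ne_zero _).mpr fun h => hj (by simp [specialJ, h])
    rwa [map_sub, map_ofNat] at this
  obtain ⟨s, hs⟩ : ∃ s : K, 64 * (4 - 3 * s) ^ 3 - φ j * (s ^ 2 * (1 - s)) = 0 := by
    obtain ⟨s, hs⟩ := IsAlgClosed.exists_root
      (C (φ j - 1728) * X ^ 3 + C (6912 - φ j) * X ^ 2 + C (-9216) * X + C 4096 : K[X])
      (by rw [degree_cubic hj1728]; decide)
    refine ⟨s, ?_⟩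
    simp only [IsRoot, eval_add, eval_mul, eval_pow, eval_C, eval_X] at hs
    linear_combination hs
  have h0 : s ≠ 0 := by
    rintro rfl
    refine mul_ne_zero h64 h64 ?_
    linear_combination hs
  have h1 : 1 - s ≠ 0 := by
    intro h
    obtain rfl : s = 1 := by linear_combination -h
    refine h64 ?_
    linear_combination hs
  have hjs : jInv s = φ j := by
    rw [jInv, div_eq_iff (mul_ne_zero (pow_ne_zero _ h0) h1)]
    linear_combination hs
  obtain ⟨w, hw⟩ := IsAlgClosed.exists_pow_nat_eq (1 - s) (n := 2) (by norm_num)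
  obtain rfl : s = 1 - w ^ 2 := by rw [hw]; ring
  have hw0 : w ≠ 0 := by rintro rfl; simp at h1
  obtain ⟨v, rfl⟩ := mem_range_of_jInv_one_sub_sq p hp hL hw0 h0
    (by rwa [hjs, ← map_specialJ, _root_.map_ne_zero])
    (by rw [hjs, aeval_algebraMap_apply, coe_aeval_eq_eval, h, map_zero])
  refine ⟨v, fun h => hw0 (by rw [h, map_zero]), fun h => h0 ?_, φ.injective ?_⟩
  · rw [← map_pow, ← map_one (algebraMap (ZMod p) K), ← map_sub, h, map_zero]
  · rw [map_jInv, map_sub, map_one, map_pow]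
    exact hjs

/-- A parameter whose dual parameter has non-special invariant is a square. -/
theorem isSquare_of_jInv (hp : 5 ≤ p) (hL : (ssPoly p).natDegree = LL p) {s : ZMod p}
    (h0 : s ≠ 0) (h1 : s ≠ 1) (hj : specialJ (jInv s) ≠ 0) (h : (ssPoly p).eval (jInv s) = 0)
    (hj' : specialJ (jInv (1 - s)) ≠ 0) : IsSquare s := by
  let K := AlgebraicClosure (ZMod p)
  let φ := algebraMap (ZMod p) K
  obtain ⟨w, hw⟩ := IsAlgClosed.exists_pow_nat_eq (φ s) (n := 2) (by norm_num)
  have hs0 : φ s ≠ 0 := (_root_.map_ne_zero _).mpr h0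
  have hs1 : 1 - φ s ≠ 0 := by
    rw [← map_one φ, ← map_sub, _root_.map_ne_zero]
    exact sub_ne_zero.mpr h1.symm
  have hφ : jInv (1 - w ^ 2) = φ (jInv (1 - s)) := by rw [hw, map_jInv, map_sub, map_one]
  have h' := aeval_jInv_one_sub_ssPoly_eq_zero p hp h0 h1 hj (by rwa [coe_aeval_eq_eval])
  obtain ⟨v, rfl⟩ := mem_range_of_jInv_one_sub_sq p hp hL (w := w)
    (by rintro rfl; simp [hs0.symm] at hw) (by rwa [hw])
    (by rwa [hφ, ← map_specialJ, _root_.map_ne_zero])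
    (by rw [hφ, aeval_algebraMap_apply, h', map_zero])
  rw [← map_pow] at hw
  exact ⟨v, by rw [← φ.injective hw, sq]⟩

/-- For `p ≡ 3 mod 4`, every non-special supersingular curve has a `2`-isogeny to a curve with
special invariant. -/
theorem exists_specialJ_of_mod_four_eq_three (hp : 5 ≤ p) (h3 : p % 4 = 3)
    (hL : (ssPoly p).natDegree = LL p) {j : ZMod p} (hj : specialJ j ≠ 0)
    (h : (ssPoly p).eval j = 0) :
    ∃ s : ZMod p, s ≠ 0 ∧ s ≠ 1 ∧ jInv s = j ∧ specialJ (jInv (1 - s)) = 0 := by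
  obtain ⟨w, h0, h1, rfl⟩ := exists_jInv_one_sub_sq_eq p hp hL hj h
  have h64 := sixtyFour_ne_zero p hp (K := ZMod p)
  have hw1 : w ≠ 1 := by rintro rfl; simp at h1
  have hw2 : w ≠ -1 := by rintro rfl; simp at h1
  have hn3 := three_mul_sub_one_ne_zero h0 h1 hj
  have hn3' := three_mul_sub_one_ne_zero (neg_ne_zero.mpr h0) (by rwa [neg_sq]) (by rwa [neg_sq])
  have hs1 := jInv_siblingParam h64 hn3
  have hs2 := jInv_siblingParam h64 hn3'
  rw [neg_sq] at hs2
  have ha := siblingParam_ne_zero h64 h0 hw1 hn3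
  have hb := siblingParam_ne_zero h64 (neg_ne_zero.mpr h0)
    (fun h => hw2 (by rw [← h, neg_neg])) hn3'
  have ha1 := siblingParam_ne_one hw2 hn3
  have hb1 := siblingParam_ne_one (fun h => hw1 (neg_injective h)) hn3'
  by_contra! hcon
  have hsq := isSquare_of_jInv p hp hL h1 (by simpa using h0) hj h (hcon _ h1 (by simpa using h0) rfl)
  have hsqa := isSquare_of_jInv p hp hL ha ha1 (by rwa [hs1]) (by rwa [hs1]) (hcon _ ha ha1 hs1)
  have hsqb := isSquare_of_jInv p hp hL hb hb1 (by rwa [hs2]) (by rwa [hs2]) (hcon _ hb hb1 hs2)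
  refine ZMod.exists_sq_eq_neg_one_iff.mp ?_ h3
  have hprod : (1 - w ^ 2) * siblingParam w * siblingParam (-w) *
      ((3 * w - 1) * (3 * w + 1) / (8 * w * (1 - w ^ 2))) ^ 2 = -1 := by
    have h8 : (8 : ZMod p) ≠ 0 := fun h8 => h64 (by linear_combination 8 * h8)
    have hn : 3 * w + 1 ≠ 0 := fun h => hn3' (by linear_combination -h)
    rw [siblingParam, siblingParam, show 3 * -w - 1 = -(3 * w + 1) by ring, neg_sq,
      show 8 * -w * (-w - 1) = 8 * w * (w + 1) by ring]
    generalize 3 * w - 1 = d at hn3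
    generalize 3 * w + 1 = e at hn
    rw [show (1 - w ^ 2) * (8 * w * (w - 1) / d ^ 2) * (8 * w * (w + 1) / e ^ 2) =
      -(8 * w * (1 - w ^ 2) / (d * e)) ^ 2 by field_simp; ring, neg_mul, ← mul_pow,
      div_mul_div_cancel₀ (mul_ne_zero hn3 hn), div_self (mul_ne_zero (mul_ne_zero h8 h0) h1),
      one_pow]
  rw [← hprod]
  exact ((hsq.mul hsqa).mul hsqb).mul (IsSquare.sq _)

section

variable {F : Type*} [Field F] [Fintype F]

theorem sum_pow_eq_ite {q : ℕ} (hq : Fintype.card F = q + 1) {k : ℕ} (hk : 0 < k)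
    (hk' : k < 2 * q) : ∑ x : F, x ^ k = if k = q then -1 else 0 := by
  classical
  have h0 : ∑ x : F, x ^ k = ∑ x : Fˣ, (x ^ k : F) := by
    rw [← Finset.sum_subset (Finset.subset_univ (Finset.univ \ {0})) (by simp [hk.ne']),
      ← Finset.sum_nbij' (s := Finset.univ) (t := Finset.univ \ {0}) (f := fun x : Fˣ => (x ^ k : F))
        (fun x : Fˣ => (x : F)) (fun x : F => if h : x = 0 then 1 else Units.mk0 x h)]
    · simp
    · simp
    · simp
    · intro x hx
      simp at hx
      simp [hx]
    · simp
  rw [h0, FiniteField.sum_pow_units, hq, Nat.add_sub_cancel]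
  congr 1
  rw [eq_iff_iff]
  refine ⟨?_, fun h => h ▸ dvd_rfl⟩
  rintro ⟨c, rfl⟩
  have hc : c < 2 := by
    by_contra! h
    nlinarith [Nat.mul_le_mul_left q h]
  have : c ≠ 0 := by rintro rfl; simp at hk
  obtain rfl : c = 1 := by omega
  simp

/-- The coefficient extraction behind the Hasse invariant of `y² = x(x² + x + b)`. -/
theorem sum_cubic_pow {n : ℕ} (hq : Fintype.card F = 2 * n + 1) (hn : 0 < n) (b : F) :
    ∑ x : F, (x * (x ^ 2 + x + b)) ^ n =
      -∑ l ∈ Finset.range (n + 1), (n.choose (2 * l) * l.centralBinom : ℕ) * b ^ l := by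
  have hexp (x : F) : (x * (x ^ 2 + x + b)) ^ n = ∑ i ∈ Finset.range (n + 1),
      ∑ l ∈ Finset.range (i + 1),
        (n.choose i * i.choose l : ℕ) * b ^ l * x ^ (2 * n + i - 2 * l) := by
    rw [mul_pow, show x ^ 2 + x + b = (b + x ^ 2) + x by ring, add_pow, Finset.mul_sum]
    refine Finset.sum_congr rfl fun i hi => ?_
    rw [add_pow, Finset.sum_mul, Finset.sum_mul, Finset.mul_sum]
    refine Finset.sum_congr rfl fun l hl => ?_
    rw [Finset.mem_range] at hi hl
    obtain ⟨r, rfl⟩ := Nat.exists_eq_add_of_le (Nat.lt_succ_iff.mp hl)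
    obtain ⟨t, rfl⟩ := Nat.exists_eq_add_of_le (Nat.lt_succ_iff.mp hi)
    rw [show 2 * (l + r + t) + (l + r) - 2 * l = (l + r + t) + 2 * r + t by omega,
      Nat.add_sub_cancel_left, Nat.add_sub_cancel_left]
    push_cast
    ring
  simp_rw [hexp]
  rw [Finset.sum_comm, ← Finset.sum_neg_distrib]
  have hinner : ∀ i ∈ Finset.range (n + 1), ∑ x : F, ∑ l ∈ Finset.range (i + 1),
      ((n.choose i * i.choose l : ℕ) * b ^ l * x ^ (2 * n + i - 2 * l) : F) =
      ∑ l ∈ Finset.range (n + 1), if i = 2 * l then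
        -((n.choose (2 * l) * l.centralBinom : ℕ) * b ^ l) else 0 := by
    intro i hi
    rw [Finset.mem_range] at hi
    rw [Finset.sum_comm, ← Finset.sum_subset (Finset.range_mono (Nat.succ_le_of_lt hi))]
    · refine Finset.sum_congr rfl fun l hl => ?_
      rw [Finset.mem_range] at hl
      rw [← Finset.mul_sum, sum_pow_eq_ite hq (by omega) (by omega)]
      by_cases h : i = 2 * l
      · rw [if_pos (by omega), if_pos h, h, Nat.centralBinom]; ring
      · rw [if_neg (by omega), if_neg h, mul_zero]
    · intro l _ hl
      rw [Finset.mem_range] at hl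
      exact if_neg (by omega)
  rw [Finset.sum_congr rfl hinner, Finset.sum_comm]
  refine Finset.sum_congr rfl fun l _ => ?_
  by_cases h : 2 * l ∈ Finset.range (n + 1)
  · rw [Finset.sum_ite_eq' , if_pos h]
  · rw [Finset.sum_ite_eq', if_neg h, Nat.choose_eq_zero_of_lt (by simpa using h)]
    simp

end

theorem choose_mul_centralBinom_succ (n l : ℕ) :
    (l + 1) ^ 2 * (n.choose (2 * (l + 1)) * (l + 1).centralBinom) =
      (n - 2 * l) * (n - (2 * l + 1)) * (n.choose (2 * l) * l.centralBinom) := by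
  have h1 := Nat.choose_succ_right_eq n (2 * l)
  have h2 := Nat.choose_succ_right_eq n (2 * l + 1)
  have h3 := Nat.succ_mul_centralBinom_succ l
  calc _ = (l + 1) * n.choose (2 * l + 1 + 1) * ((l + 1) * (l + 1).centralBinom) := by
        rw [show 2 * (l + 1) = 2 * l + 1 + 1 by ring]; ring
    _ = n.choose (2 * l + 1 + 1) * (2 * l + 1 + 1) * (2 * l + 1) * l.centralBinom := by
        rw [h3]; ring
    _ = n.choose (2 * l + 1) * (2 * l + 1) * (n - (2 * l + 1)) * l.centralBinom := by
        rw [h2]; ring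
    _ = _ := by rw [h1]; ring

theorem coeff_eq_of_hypOp_eq_zero {n : ℕ} (hpn : p = 2 * n + 1) (hp : 5 ≤ p) {f : (ZMod p)[X]}
    (hf : hypOp f = 0) {l : ℕ} (hl : l < p) :
    4 ^ l * f.coeff l = f.coeff 0 * (n.choose (2 * l) * l.centralBinom : ℕ) := by
  have hn : (2 : ZMod p) * n + 1 = 0 := by
    have : ((2 * n + 1 : ℕ) : ZMod p) = 0 := by rw [← hpn, ZMod.natCast_self]
    exact_mod_cast this
  have h16 : (16 : ZMod p) ≠ 0 := by
    have := pow_ne_zero 4 (two_ne_zero_of_five_le p hp)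
    norm_num at this
    exact this
  induction l with
  | zero => simp
  | succ l ih =>
    have hrec := coeff_succ_of_hypOp_eq_zero hf l
    have hl1 := succ_ne_zero_of_lt p hl
    refine mul_left_cancel₀ (pow_ne_zero 2 hl1) ?_
    have hc : ((l : ZMod p) + 1) ^ 2 *
        (n.choose (2 * (l + 1)) * (l + 1).centralBinom : ℕ) =
        4 * (l ^ 2 + l + 3 / 16) * (n.choose (2 * l) * l.centralBinom : ℕ) := by
      have := congrArg (Nat.cast : ℕ → ZMod p) (choose_mul_centralBinom_succ n l)
      rw [Nat.cast_mul] at this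
      rw [show ((l : ZMod p) + 1) ^ 2 = (((l + 1) ^ 2 : ℕ) : ZMod p) by push_cast; ring, this,
        Nat.cast_mul, Nat.cast_mul]
      rcases lt_or_ge n (2 * l + 1) with h | h
      · rw [Nat.sub_eq_zero_of_le h.le]
        rcases (Nat.lt_succ_iff.mp h).lt_or_eq with h' | h'
        · simp [Nat.choose_eq_zero_of_lt h']
        · have : (4 : ZMod p) * (l ^ 2 + l + 3 / 16) = 0 := by
            rw [h'] at hn
            push_cast at hn
            field_simp
            linear_combination 4 * (4 * (l : ZMod p) + 3) * hn
          rw [this]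
          simp
      · rw [Nat.cast_sub h, Nat.cast_sub (by omega)]
        congr 1
        push_cast
        field_simp
        linear_combination (8 * (n : ZMod p) - 32 * l - 12) * hn
    calc _ = 4 ^ l * 4 * ((l + 1) ^ 2 * f.coeff (l + 1)) := by ring
      _ = 4 * (l ^ 2 + l + 3 / 16) * (4 ^ l * f.coeff l) := by rw [hrec]; ring
      _ = f.coeff 0 * (((l : ZMod p) + 1) ^ 2 *
        (n.choose (2 * (l + 1)) * (l + 1).centralBinom : ℕ)) := by rw [ih (by omega), hc]; ring
      _ = _ := by ring

/-- The roots of the pullback of the supersingular polynomial have vanishing Hasse invariant. -/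
theorem sum_cubic_pow_eq_zero {n : ℕ} (hpn : p = 2 * n + 1) (hp : 5 ≤ p) {b : ZMod p}
    (h : (ssPullback p).eval (4 * b) = 0) :
    ∑ x : ZMod p, (x * (x ^ 2 + x + b)) ^ n = 0 := by
  rw [sum_cubic_pow (by rw [ZMod.card, hpn]) (by omega), neg_eq_zero]
  refine (mul_eq_zero.mp (?_ : (ssPullback p).coeff 0 * _ = 0)).resolve_left
    (coeff_zero_ssPullback_ne_zero p hp)
  rw [eval_eq_sum_range' (natDegree_ssPullback_lt p hp)] at h
  rw [Finset.sum_subset (Finset.range_mono (by omega : n + 1 ≤ p)), Finset.mul_sum, ← h]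
  · refine Finset.sum_congr rfl fun l hl => ?_
    rw [← mul_assoc, ← coeff_eq_of_hypOp_eq_zero p hpn hp (hypOp_ssPullback p hp)
      (Finset.mem_range.mp hl), mul_pow]
    ring
  · intro l _ hl
    rw [Nat.choose_eq_zero_of_lt (by simp at hl; omega)]
    simp

/-- A curve with full rational `2`-torsion has a number of points divisible by `4`, which excludes
trace zero when `p ≡ 1 mod 4`. -/
theorem sum_cubic_pow_ne_zero {n : ℕ} (hpn : p = 2 * n + 1) (hp4 : p % 4 = 1) {b w : ZMod p}
    (hb : b ≠ 0) (hw : w ≠ 0) (hbw : 4 * b = 1 - w ^ 2) :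
    ∑ x : ZMod p, (x * (x ^ 2 + x + b)) ^ n ≠ 0 := by
  classical
  intro h
  have hp2 : (2 : ZMod p) ≠ 0 := by
    intro h2
    have := (ZMod.natCast_eq_zero_iff 2 p).mp (by exact_mod_cast h2)
    have := Nat.le_of_dvd (by norm_num) this
    have := (Fact.out : p.Prime).two_le
    omega
  set f : ZMod p → ZMod p := fun x => x * (x ^ 2 + x + b) with hf
  set χ := quadraticChar (ZMod p) with hχ
  have hchar : ringChar (ZMod p) ≠ 2 := by
    rw [ZMod.ringChar_zmod_n]; omega
  have hdvd : (p : ℤ) ∣ ∑ x, χ (f x) := by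
    rw [← ZMod.intCast_zmod_eq_zero_iff_dvd, Int.cast_sum, ← h]
    refine Finset.sum_congr rfl fun x _ => ?_
    rw [hχ, quadraticChar_eq_pow_of_char_ne_two' hchar, ZMod.card, show p / 2 = n by omega]
  have hχ0 : χ 0 = 0 := quadraticChar_zero
  set A := Finset.univ.filter fun x => χ (f x) = 1 with hA
  set Z := Finset.univ.filter fun x => f x = 0 with hZ
  have hZcard : Z.card = 3 := by
    have : Z = {0, (-1 + w) / 2, (-1 - w) / 2} := by
      ext x
      have hfac : f x = x * (x - (-1 + w) / 2) * (x - (-1 - w) / 2) := by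
        simp only [hf]
        field_simp
        linear_combination x * hbw
      simp [hZ, hfac, sub_eq_zero, or_assoc]
    rw [this, Finset.card_eq_three]
    have h4 : (4 : ZMod p) ≠ 0 := by
      have := pow_ne_zero 2 hp2
      norm_num at this
      exact this
    have hw2 : (1 - w) * (1 + w) ≠ 0 := by
      rw [show (1 - w) * (1 + w) = 4 * b by rw [hbw]; ring]
      exact mul_ne_zero h4 hb
    refine ⟨0, _, _, (div_ne_zero (fun h => hw2 ?_) hp2).symm,
      (div_ne_zero (fun h => hw2 ?_) hp2).symm, fun h => hw ?_, rfl⟩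
    · linear_combination -(1 + w) * h
    · linear_combination -(1 - w) * h
    · rw [div_left_inj' hp2] at h
      refine (mul_eq_zero.mp (?_ : 2 * w = 0)).resolve_left hp2
      linear_combination h
  have hsum : ∑ x, χ (f x) + (p - 3 : ℤ) = 2 * A.card := by
    have hterm (x : ZMod p) : χ (f x) + (1 - if f x = 0 then 1 else 0) =
        2 * if χ (f x) = 1 then 1 else 0 := by
      by_cases h0 : f x = 0
      · simp [h0, hχ0]
      · rcases quadraticChar_dichotomy h0 with h1 | h1 <;> simp [hχ, h0, h1]
    have := Finset.sum_congr rfl fun (x : ZMod p) (_ : x ∈ Finset.univ) => hterm x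
    rw [Finset.sum_add_distrib, Finset.sum_sub_distrib, ← Finset.mul_sum, Finset.sum_boole,
      Finset.sum_boole, ← hA, ← hZ, hZcard] at this
    simpa [ZMod.card] using this
  have hle : A.card + 3 ≤ p := by
    rw [← hZcard, ← Finset.card_union_of_disjoint]
    · exact (Finset.card_le_univ _).trans (ZMod.card p).le
    · rw [Finset.disjoint_left]
      intro x hx hx'
      simp only [hA, hZ, Finset.mem_filter] at hx hx'
      simp [hx'.2, hχ0] at hx
  have hzero : ∑ x, χ (f x) = 0 := by
    obtain ⟨c, hc⟩ := hdvd
    have : c = 0 := by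
      have h1 : c < 1 := by by_contra! h1; nlinarith
      have h2 : -1 < c := by by_contra! h1; nlinarith
      omega
    rw [hc, this, mul_zero]
  have heven : Even A.card := by
    have : ∑ x ∈ A, (1 : ZMod 2) = 0 := by
      have hx0 : ∀ x ∈ A, x ≠ 0 := by
        rintro x hx rfl
        simp [hA, hf, hχ0] at hx
      refine Finset.sum_involution (fun x _ => if x ^ 2 = b then -x else b / x) ?_ ?_ ?_ ?_
      · intros; decide
      · intro x hx _ hfix
        have := hx0 x hx
        split_ifs at hfix with hxb
        · have : 2 * x = 0 := by linear_combination -hfix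
          simp_all
        · rw [div_eq_iff this] at hfix
          exact hxb (by rw [hfix]; ring)
      · intro x hx
        have hx' := hx0 x hx
        simp only [hA, Finset.mem_filter, Finset.mem_univ, true_and] at hx ⊢
        split_ifs with hxb
        · have hmul : f x * f (-x) = (b * w) ^ 2 := by
            simp only [hf]
            rw [← hxb] at hbw ⊢
            linear_combination -x ^ 4 * hbw
          have h1 : χ ((b * w) ^ 2) = 1 := quadraticChar_sq_one' (mul_ne_zero hb hw)
          rwa [← hmul, map_mul, hx, one_mul] at h1
        · have hmul : f (b / x) = (b / x ^ 2) ^ 2 * f x := by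
            simp only [hf]
            field_simp
            ring
          rw [hmul, map_mul, hx, mul_one]
          exact quadraticChar_sq_one' (div_ne_zero hb (pow_ne_zero 2 hx'))
      · intro x hx
        have hx' := hx0 x hx
        by_cases hxb : x ^ 2 = b
        · simp [hxb]
        · have : (b / x) ^ 2 ≠ b := by
            intro h
            field_simp at h
            exact hxb h.symm
          simp only [if_neg hxb, if_neg this]
          field_simp
    rw [Finset.sum_const, nsmul_one] at this
    exact (ZMod.natCast_eq_zero_iff_even).mp this
  obtain ⟨c, hc⟩ := heven
  omega

/-- For `p ≡ 1 mod 4`, supersingular curves with rational invariants have special invariant. -/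
theorem specialJ_eq_zero_of_mod_four_eq_one (hp : 5 ≤ p) (h1 : p % 4 = 1)
    (hL : (ssPoly p).natDegree = LL p) {j : ZMod p} (h : (ssPoly p).eval j = 0) :
    specialJ j = 0 := by
  by_contra hj
  obtain ⟨w, h0, hs, rfl⟩ := exists_jInv_one_sub_sq_eq p hp hL hj h
  have h4 : (4 : ZMod p) ≠ 0 := by
    have := pow_ne_zero 2 (two_ne_zero_of_five_le p hp)
    norm_num at this
    exact this
  have hev := aeval_ssPullback_eq_zero p hp hs (by simpa using h0) hj (by rwa [coe_aeval_eq_eval])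
  have hbw : 4 * ((1 - w ^ 2) / 4) = 1 - w ^ 2 := mul_div_cancel₀ _ h4
  refine sum_cubic_pow_ne_zero p (n := p / 2) (by omega) h1 (div_ne_zero hs h4) h0 hbw
    (sum_cubic_pow_eq_zero p (by omega) hp ?_)
  rwa [hbw, ← coe_aeval_eq_eval]

/-- The bound `deg ss_p ≤ 16` when all supersingular invariants are rational. -/
theorem natDegree_ssPoly_le (hp : 5 ≤ p) (hL : (ssPoly p).natDegree = LL p) :
    (ssPoly p).natDegree ≤ 16 := by
  classical
  have h64 := sixtyFour_ne_zero p hp (K := ZMod p)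
  let P : (ZMod p)[X] := specialJ X
  let G : (ZMod p)[X] := (1 + 3 * X) * (9 * X - 1) *
    (64 * (1 + 3 * X) ^ 3 + 3375 * ((1 - X) ^ 2 * X)) *
    (4096 * (1 + 3 * X) ^ 6 + 191025 * 64 * (1 + 3 * X) ^ 3 * ((1 - X) ^ 2 * X)
      - 121287375 * ((1 - X) ^ 2 * X) ^ 2)
  have hP (x : ZMod p) : P.eval x = specialJ x := by
    simpa using map_specialJ (evalRingHom x) X
  have hP0 : P ≠ 0 := by
    have hm : P.Monic := by
      simp only [P, specialJ]
      have h1 : (X - 1728 : (ZMod p)[X]).Monic := by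
        monicity!
      have h2 : (X + 3375 : (ZMod p)[X]).Monic := by
        monicity!
      have h3 : (X ^ 2 + 191025 * X - 121287375 : (ZMod p)[X]).Monic := by
        monicity!
      exact ((monic_X.mul h1).mul h2).mul h3
    exact hm.ne_zero
  have hG0 : G ≠ 0 := by
    intro h
    refine neg_ne_zero.mpr (mul_ne_zero h64 (mul_ne_zero h64 h64)) ?_
    calc -(64 * (64 * 64)) = G.eval 0 := by
          simp only [G, eval_mul, eval_add, eval_sub, eval_pow, eval_X, eval_one, eval_ofNat]
          norm_num
      _ = 0 := by rw [h, eval_zero]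
  have hPd : P.natDegree ≤ 5 := by
    simp only [P, specialJ]
    compute_degree
  have hGd : G.natDegree ≤ 11 := by
    simp only [G]
    compute_degree
  have hsub : (ssPoly p).roots.toFinset ⊆
      P.roots.toFinset ∪ G.roots.toFinset.image jInv := by
    intro j hj
    have hj0 : (ssPoly p).eval j = 0 := (mem_roots'.mp (Multiset.mem_toFinset.mp hj)).2
    rw [Finset.mem_union]
    by_cases hsp : specialJ j = 0
    · left
      rw [Multiset.mem_toFinset, mem_roots hP0, IsRoot, hP, hsp]
    right
    have h3 : p % 4 = 3 := by
      have h1 : p % 4 ≠ 1 := fun h1 => hsp (specialJ_eq_zero_of_mod_four_eq_one p hp h1 hL hj0)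
      have := (Fact.out : p.Prime).eq_two_or_odd
      omega
    obtain ⟨s, h0, h1, rfl, hs⟩ := exists_specialJ_of_mod_four_eq_three p hp h3 hL hsp hj0
    have h1' : 1 - s ≠ 0 := sub_ne_zero.mpr h1.symm
    refine Finset.mem_image_of_mem _ ?_
    rw [Multiset.mem_toFinset, mem_roots hG0, IsRoot]
    have hD : (1 - s) ^ 2 * s ≠ 0 := mul_ne_zero (pow_ne_zero _ h1') h0
    have hj1 : (1 - s) ^ 2 * s * jInv (1 - s) = 64 * (1 + 3 * s) ^ 3 := by
      rw [jInv, sub_sub_cancel, mul_div_cancel₀ _ hD]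
      ring
    have hzero : 64 * (1 + 3 * s) ^ 3 * (64 * (9 * s - 1) ^ 2) *
        (64 * (1 + 3 * s) ^ 3 + 3375 * ((1 - s) ^ 2 * s)) *
        (4096 * (1 + 3 * s) ^ 6 + 191025 * 64 * (1 + 3 * s) ^ 3 * ((1 - s) ^ 2 * s)
          - 121287375 * ((1 - s) ^ 2 * s) ^ 2) = 0 := by
      have h1728 : 64 * (9 * s - 1) ^ 2 = 64 * (1 + 3 * s) ^ 3 - 1728 * ((1 - s) ^ 2 * s) := by
        ring
      have h6 : 4096 * (1 + 3 * s) ^ 6 = (64 * (1 + 3 * s) ^ 3) ^ 2 := by ring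
      rw [h1728, h6, mul_assoc 191025, ← hj1]
      rw [specialJ] at hs
      linear_combination ((1 - s) ^ 2 * s) ^ 5 * hs
    simp only [G, eval_mul, eval_add, eval_sub, eval_pow, eval_X, eval_one, eval_ofNat]
    simpa [h64] using hzero
  calc (ssPoly p).natDegree = (ssPoly p).roots.toFinset.card := hL
    _ ≤ _ := Finset.card_le_card hsub
    _ ≤ P.roots.toFinset.card + G.roots.toFinset.card :=
        (Finset.card_union_le _ _).trans (Nat.add_le_add_left Finset.card_image_le _)
    _ ≤ 5 + 11 := add_le_add
        ((Multiset.toFinset_card_le _).trans ((card_roots' _).trans hPd))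
        ((Multiset.toFinset_card_le _).trans ((card_roots' _).trans hGd))

/-- Division-free Horner evaluation of the hypergeometric factor of `ss_p` at `x`, modulo `p`: the
pair of the current coefficient and the current partial value, up to a common unit. -/
def ssHorner (p e d x : ℕ) : ℕ → ℕ × ℕ
  | 0 => (1, 1)
  | n + 1 => match ssHorner p e d x n with
    | (a, t) =>
      let a' := a * (p + n - p / 12) * (12 * n + 5 + 6 * e - 4 * d) * 1728 % p
      (a', (t * (12 * (n + 1) ^ 2) * x + a') % p)

/-- A number that vanishes modulo `p` if and only if `ss_p` vanishes at `x`. -/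
def ssValue (p e d x : ℕ) : ℕ :=
  (ssHorner p e d x (p / 12)).2 * x ^ d * (x + 1728 * (p - 1)) ^ e

theorem ssHorner_cast (hp : 5 ≤ p) (x : ℕ) {n : ℕ} (hn : n ≤ p / 12) :
    ((ssHorner p (eps p) (del p) x n).1 : ZMod p) =
        12 ^ n * (n.factorial : ZMod p) ^ 2 * 1728 ^ n * ssCoeff p n ∧
      ((ssHorner p (eps p) (del p) x n).2 : ZMod p) = 12 ^ n * (n.factorial : ZMod p) ^ 2 *
        ∑ k ∈ Finset.range (n + 1), ssCoeff p k * 1728 ^ k * (x : ZMod p) ^ (n - k) := by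
  induction n with
  | zero => simp [ssHorner, ssCoeff_zero]
  | succ n ih =>
    obtain ⟨iha, iht⟩ := ih (by omega)
    have hd : del p ≤ 1 := by rw [del_eq p hp]; split_ifs <;> simp
    have ha : ((ssHorner p (eps p) (del p) x (n + 1)).1 : ZMod p) =
        12 ^ (n + 1) * ((n + 1).factorial : ZMod p) ^ 2 * 1728 ^ (n + 1) * ssCoeff p (n + 1) := by
      simp only [ssHorner, ZMod.natCast_mod]
      rw [Nat.cast_mul, Nat.cast_mul, Nat.cast_mul, iha, Nat.cast_sub (by omega),
        Nat.cast_sub (by omega), Nat.factorial_succ]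
      push_cast
      rw [ZMod.natCast_self]
      linear_combination (-(12 : ZMod p) ^ n * n.factorial ^ 2 * 1728 ^ (n + 1)) *
        ssCoeff_succ p hp (show n + 1 < p by omega)
    refine ⟨ha, ?_⟩
    have ht : (ssHorner p (eps p) (del p) x (n + 1)).2 =
      ((ssHorner p (eps p) (del p) x n).2 * (12 * (n + 1) ^ 2) * x +
        (ssHorner p (eps p) (del p) x (n + 1)).1) % p := rfl
    rw [ht, ZMod.natCast_mod, Nat.cast_add, ha, Nat.cast_mul, Nat.cast_mul, iht,
      Finset.sum_range_succ _ (n + 1), Nat.factorial_succ]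
    have hsum : ∑ k ∈ Finset.range (n + 1), ssCoeff p k * 1728 ^ k * (x : ZMod p) ^ (n + 1 - k) =
        x * ∑ k ∈ Finset.range (n + 1), ssCoeff p k * 1728 ^ k * (x : ZMod p) ^ (n - k) := by
      rw [Finset.mul_sum]
      refine Finset.sum_congr rfl fun k hk => ?_
      rw [Nat.succ_sub (Nat.lt_succ_iff.mp (Finset.mem_range.mp hk)), pow_succ]
      ring
    rw [hsum]
    push_cast
    simp only [Nat.sub_self]
    ring

theorem eval_ssPoly_natCast_eq_zero_iff (hp : 5 ≤ p) (x : ℕ) :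
    (ssPoly p).eval (x : ZMod p) = 0 ↔ ssValue p (eps p) (del p) x % p = 0 := by
  have hp1 := (Fact.out : p.Prime).one_le
  have hunit : (12 : ZMod p) ^ (p / 12) * ((p / 12).factorial : ZMod p) ^ 2 ≠ 0 := by
    refine mul_ne_zero (pow_ne_zero _ (twelve_ne_zero_of_five_le p hp)) (pow_ne_zero _ ?_)
    rw [Ne, ZMod.natCast_eq_zero_iff, (Fact.out : p.Prime).dvd_factorial]
    omega
  have hval : (ssValue p (eps p) (del p) x : ZMod p) =
      12 ^ (p / 12) * ((p / 12).factorial : ZMod p) ^ 2 * (ssPoly p).eval (x : ZMod p) := by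
    rw [ssValue, Nat.cast_mul, Nat.cast_mul, (ssHorner_cast p hp x le_rfl).2, ssPoly_eq]
    have hsum : ∑ k ∈ Finset.range (p / 12 + 1),
          ssCoeff p k * 1728 ^ k * (x : ZMod p) ^ (p / 12 + del p - k) =
        x ^ del p * ∑ k ∈ Finset.range (p / 12 + 1),
          ssCoeff p k * 1728 ^ k * (x : ZMod p) ^ (p / 12 - k) := by
      rw [Finset.mul_sum]
      refine Finset.sum_congr rfl fun k hk => ?_
      rw [Finset.mem_range] at hk
      rw [show p / 12 + del p - k = del p + (p / 12 - k) by omega]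
      ring
    simp only [eval_mul, eval_pow, eval_sub, eval_X, eval_C, eval_finsetSum, hsum]
    rw [Nat.cast_pow, Nat.cast_pow, Nat.cast_add, Nat.cast_mul, Nat.cast_sub hp1,
      ZMod.natCast_self]
    push_cast
    ring
  rw [← Nat.dvd_iff_mod_eq_zero, ← ZMod.natCast_eq_zero_iff, hval, mul_eq_zero, or_iff_right hunit]

theorem LL_eq_count (hp : 5 ≤ p) :
    LL p = Nat.count (fun x => ssValue p (eps p) (del p) x % p = 0) p := by
  rw [LL, Nat.count_eq_card_filter_range]
  refine (Finset.card_nbij' (fun x : ℕ => (x : ZMod p)) ZMod.val ?_ ?_ ?_ ?_).symm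
  · intro x hx
    simp only [Finset.coe_filter, Finset.mem_range, Set.mem_ofPred_eq] at hx
    simp only [Finset.mem_coe, Multiset.mem_toFinset]
    rw [mem_roots (monic_natDegree_ssPoly p).1.ne_zero]
    exact (eval_ssPoly_natCast_eq_zero_iff p hp x).mpr hx.2
  · intro x hx
    simp only [Finset.mem_coe, Multiset.mem_toFinset] at hx
    rw [mem_roots (monic_natDegree_ssPoly p).1.ne_zero, IsRoot] at hx
    simp only [Finset.coe_filter, Finset.mem_range, Set.mem_ofPred_eq]
    refine ⟨ZMod.val_lt x, (eval_ssPoly_natCast_eq_zero_iff p hp _).mp ?_⟩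
    rwa [ZMod.natCast_zmod_val]
  · intro x hx
    simp only [Finset.coe_filter, Finset.mem_range, Set.mem_ofPred_eq] at hx
    exact ZMod.val_cast_of_lt hx.1
  · intro x _
    exact ZMod.natCast_zmod_val x

theorem count_eq_iff_dvd_monsterOrder : ∀ q < 194, 5 ≤ q → (∀ d < q, 2 ≤ d → ¬d ∣ q) →
    (q / 12 + (if q % 3 = 1 then 0 else 1) + (if q % 4 = 1 then 0 else 1) =
      Nat.count (fun x => ssValue q (if q % 4 = 1 then 0 else 1) (if q % 3 = 1 then 0 else 1) x
        % q = 0) q ↔ q ∣ monsterOrder) := by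
  decide +kernel

theorem le_of_prime_dvd_monsterOrder {q : ℕ} (hq : q.Prime) (h : q ∣ monsterOrder) : q ≤ 71 := by
  have hdvd : monsterOrder ∣ Nat.factorial 71 ^ 46 := by decide +kernel
  exact hq.dvd_factorial.mp (hq.dvd_of_dvd_pow (h.trans hdvd))

/-- For every prime p ≥ 5, deg ss_p(X) = L(p) if and only if p divides the order of the
Monster simple group 𝕄. -/
theorem deg_ssp_eq_L_iff_dvd_monster (hp : 5 ≤ p) :
    (ssPoly p).natDegree = LL p ↔ p ∣ monsterOrder := by
  have hpr := (Fact.out : p.Prime)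
  by_cases h194 : p < 194
  · rw [(monic_natDegree_ssPoly p).2, LL_eq_count p hp, del_eq p hp, eps_eq p hp]
    exact count_eq_iff_dvd_monsterOrder p h194 hp fun d hd h2 hdvd =>
      absurd ((Nat.dvd_prime hpr).mp hdvd) (by omega)
  · refine iff_of_false (fun hL => ?_) fun h => ?_
    · have h16 := natDegree_ssPoly_le p hp hL
      rw [(monic_natDegree_ssPoly p).2] at h16
      have := twelve_mul_div_add p hp
      omega
    · have := le_of_prime_dvd_monsterOrder hpr h
      omega
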